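/- arXiv:1704.08597 — 15 statements merged into one kernel-verified Lean document; each statement's English description precedes it below -/
import Mathlib

section
/- Let 0 ≤ p < 1 and let N : ℕ → ℕ → ℝ (with N(k,t) the value at degree k and time t) satisfy the initial conditions N(1,1) = 2 and N(k,1) = 0 for every k ≥ 2, and for all integers t ≥ 1 the recursions: N(1,t+1) = (1 − (1−p)/(2t))·N(1,t) + (1−p); N(2,t+1) = (1 − (1−p)/t)·N(2,t) + ((1−p)/(2t))·N(1,t) + p; and for every k > 2, N(k,t+1) = (1 − (1−p)k/(2t))·N(k,t) + ((1−p)(k−1)/(2t))·N(k−1,t). Then for every k ≥ 1 the limit P(k) = lim_{t→∞} N(k,t)/t exists, and P(1) = 2(1−p)/(3−p), P(2) = (1−p)²/((2−p)(3−p)) + p/(2−p), and for every k > 2, P(k) = (2/(1−p)+2)·(2/(1−p)+1)·B(k, 1+2/(1−p))·P(2), where B denotes the Euler Beta function. -/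
open Filter

/-- Euler Beta function `B(x,y) = Γ(x)Γ(y)/Γ(x+y)`. -/
noncomputable def euBeta (x y : ℝ) : ℝ := Real.Gamma x * Real.Gamma y / Real.Gamma (x + y)

theorem conv_aux (b c : ℝ) (hb : 0 ≤ b) (x u : ℕ → ℝ)
    (hx : ∀ t : ℕ, 1 ≤ t → x (t + 1) = (1 - b / t) * x t + u t)
    (hu : Tendsto u atTop (nhds c)) :
    Tendsto (fun t : ℕ => x t / t) atTop (nhds (c / (1 + b))) := by
  set L := c / (1 + b) with hL
  have hLc : L * (1 + b) = c := by rw [hL]; field_simp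
  obtain ⟨T, hT⟩ := exists_nat_ge (max b 1)
  have hTb : b ≤ T := (le_max_left _ _).trans hT
  have hT1 : 1 ≤ T := by exact_mod_cast (le_max_right _ _).trans hT
  have he : Tendsto (fun t => |u t - c|) atTop (nhds 0) := by
    have := (hu.sub_const c).abs
    simpa using this
  have hces := he.cesaro
  have hbound : ∀ t : ℕ, T ≤ t →
      |x t - L * t| ≤ |x T - L * T| + ∑ i ∈ Finset.range t, |u i - c| := by
    intro t ht
    induction t, ht using Nat.le_induction with
    | base =>
      have : 0 ≤ ∑ i ∈ Finset.range T, |u i - c| := Finset.sum_nonneg fun _ _ => abs_nonneg _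
      linarith
    | succ t ht ih =>
      have ht1 : 1 ≤ t := hT1.trans ht
      have htpos : (0 : ℝ) < t := by exact_mod_cast ht1
      have htT : (T : ℝ) ≤ t := by exact_mod_cast ht
      have hbt : b / t ≤ 1 := by rw [div_le_one htpos]; linarith
      have hbt0 : 0 ≤ b / t := by positivity
      have e1 : x (t + 1) - L * ((t + 1 : ℕ) : ℝ)
          = (1 - b / t) * (x t - L * t) + (u t - c) := by
        rw [hx t ht1, ← hLc]
        push_cast
        field_simp
        ring
      rw [e1, Finset.sum_range_succ]
      have h1 := abs_add_le ((1 - b / t) * (x t - L * t)) (u t - c)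
      have h2 : |(1 - b / t) * (x t - L * t)| ≤ |x t - L * t| := by
        rw [abs_mul, abs_of_nonneg (by linarith : 0 ≤ 1 - b / t)]
        exact mul_le_of_le_one_left (abs_nonneg _) (by linarith)
      linarith
  have hlim : Tendsto (fun t : ℕ => |x T - L * T| / (t : ℝ)
      + (t : ℝ)⁻¹ * ∑ i ∈ Finset.range t, |u i - c|) atTop (nhds 0) := by
    simpa using (tendsto_const_div_atTop_nhds_zero_nat |x T - L * T|).add hces
  rw [tendsto_iff_norm_sub_tendsto_zero]
  refine squeeze_zero' (Eventually.of_forall fun _ => norm_nonneg _) ?_ hlim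
  filter_upwards [eventually_ge_atTop T] with t ht
  have htpos : (0 : ℝ) < t := by exact_mod_cast hT1.trans ht
  have e2 : x t / t - L = (x t - L * t) / t := by field_simp
  rw [Real.norm_eq_abs, e2, abs_div, abs_of_pos htpos, inv_mul_eq_div, ← add_div]
  gcongr
  exact hbound t ht

theorem euBeta_two (c : ℝ) (hc : 0 < c) :
    (c + 2) * (c + 1) * euBeta (2 : ℕ) (1 + c) = 1 := by
  unfold euBeta
  have h1 : Real.Gamma (((2 : ℕ) : ℝ) + (1 + c)) = (c + 2) * ((c + 1) * Real.Gamma (1 + c)) := by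
    rw [show ((2 : ℕ) : ℝ) + (1 + c) = (c + 2) + 1 by push_cast; ring,
      Real.Gamma_add_one (by positivity), show c + 2 = (c + 1) + 1 by ring,
      Real.Gamma_add_one (by positivity), add_comm 1 c]
  have h2 : Real.Gamma ((2 : ℕ) : ℝ) = 1 := by
    push_cast; exact Real.Gamma_two
  have h3 : Real.Gamma (1 + c) ≠ 0 := (Real.Gamma_pos_of_pos (by positivity)).ne'
  rw [h1, h2]
  field_simp

theorem euBeta_succ (c : ℝ) (hc : 0 < c) (k : ℕ) (hk : 2 ≤ k) :
    euBeta (k + 1 : ℕ) (1 + c) = k / (k + 1 + c) * euBeta k (1 + c) := by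
  unfold euBeta
  have hk0 : (0 : ℝ) < k := by exact_mod_cast (by omega : 0 < k)
  have h1 : Real.Gamma (((k + 1 : ℕ) : ℝ) + (1 + c))
      = (k + 1 + c) * Real.Gamma (k + (1 + c)) := by
    rw [show ((k + 1 : ℕ) : ℝ) + (1 + c) = (k + (1 + c)) + 1 by push_cast; ring,
      Real.Gamma_add_one (by positivity)]
    ring
  have h2 : Real.Gamma ((k + 1 : ℕ) : ℝ) = k * Real.Gamma k := by
    push_cast; exact Real.Gamma_add_one hk0.ne'
  have h3 : Real.Gamma (k + (1 + c)) ≠ 0 := (Real.Gamma_pos_of_pos (by positivity)).ne'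
  rw [h1, h2]
  field_simp

theorem stmt_0 (p : ℝ) (hp0 : 0 ≤ p) (hp1 : p < 1) (N : ℕ → ℕ → ℝ)
    (hinit1 : N 1 1 = 2)
    (hinit : ∀ k : ℕ, 2 ≤ k → N k 1 = 0)
    (hrec1 : ∀ t : ℕ, 1 ≤ t →
      N 1 (t + 1) = (1 - (1 - p) / (2 * t)) * N 1 t + (1 - p))
    (hrec2 : ∀ t : ℕ, 1 ≤ t →
      N 2 (t + 1) = (1 - (1 - p) / t) * N 2 t + ((1 - p) / (2 * t)) * N 1 t + p)
    (hreck : ∀ t : ℕ, 1 ≤ t → ∀ k : ℕ, 2 < k →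
      N k (t + 1) = (1 - (1 - p) * k / (2 * t)) * N k t
        + ((1 - p) * ((k : ℝ) - 1) / (2 * t)) * N (k - 1) t) :
    ∃ P : ℕ → ℝ,
      (∀ k : ℕ, 1 ≤ k → Tendsto (fun t : ℕ => N k t / t) atTop (nhds (P k))) ∧
      P 1 = 2 * (1 - p) / (3 - p) ∧
      P 2 = (1 - p) ^ 2 / ((2 - p) * (3 - p)) + p / (2 - p) ∧
      (∀ k : ℕ, 2 < k →
        P k = (2 / (1 - p) + 2) * (2 / (1 - p) + 1) * euBeta k (1 + 2 / (1 - p)) * P 2) := by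
  have ha : 0 < 1 - p := by linarith
  have hc : 0 < 2 / (1 - p) := by positivity
  have h2p : 0 < 2 - p := by linarith
  have h3p : 0 < 3 - p := by linarith
  obtain ⟨q, hq⟩ : ∃ q, q = (1 - p) ^ 2 / ((2 - p) * (3 - p)) + p / (2 - p) := ⟨_, rfl⟩
  have hP1 : Tendsto (fun t : ℕ => N 1 t / t) atTop (nhds (2 * (1 - p) / (3 - p))) := by
    have := conv_aux ((1 - p) / 2) (1 - p) (by positivity) (N 1) (fun _ => 1 - p)
      (fun t ht => by rw [hrec1 t ht, div_div]) tendsto_const_nhds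
    convert this using 2
    have : 1 + (1 - p) / 2 ≠ 0 := by positivity
    field_simp
    ring
  have hP2 : Tendsto (fun t : ℕ => N 2 t / t) atTop (nhds q) := by
    have := conv_aux (1 - p) ((1 - p) / 2 * (2 * (1 - p) / (3 - p)) + p) ha.le (N 2)
      (fun t => (1 - p) / 2 * (N 1 t / t) + p)
      (fun t ht => by
        have htpos : (0 : ℝ) < t := by exact_mod_cast ht
        rw [hrec2 t ht]; field_simp; ring)
      ((hP1.const_mul _).add_const _)
    convert this using 2
    rw [hq, show 1 + (1 - p) = 2 - p by ring]
    field_simp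
  have hPk : ∀ k : ℕ, 2 ≤ k → Tendsto (fun t : ℕ => N k t / t) atTop
      (nhds ((2 / (1 - p) + 2) * (2 / (1 - p) + 1) * euBeta k (1 + 2 / (1 - p)) * q)) := by
    intro k hk
    induction k, hk using Nat.le_induction with
    | base => rw [euBeta_two _ hc, one_mul]; exact hP2
    | succ k hk ih =>
      have hk0 : (0 : ℝ) < k := by exact_mod_cast (by omega : 0 < k)
      have := conv_aux ((1 - p) * (k + 1) / 2) _ (by positivity) (N (k + 1))
        (fun t => (1 - p) * k / 2 * (N k t / t))
        (fun t ht => by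
          have htpos : (0 : ℝ) < t := by exact_mod_cast ht
          rw [hreck t ht (k + 1) (by omega), Nat.add_sub_cancel]
          push_cast
          field_simp
          ring)
        (ih.const_mul _)
      convert this using 2
      rw [euBeta_succ _ hc k hk]
      generalize euBeta k (1 + 2 / (1 - p)) = B
      have e : (k : ℝ) / (k + 1 + 2 / (1 - p))
          = (1 - p) * k / 2 / (1 + (1 - p) * (k + 1) / 2) := by
        rw [div_eq_div_iff (by positivity) (by positivity)]
        field_simp
        ring
      rw [e]
      ring
  refine ⟨fun k => if k = 1 then 2 * (1 - p) / (3 - p) else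
    (2 / (1 - p) + 2) * (2 / (1 - p) + 1) * euBeta k (1 + 2 / (1 - p)) * q, ?_, ?_, ?_, ?_⟩
  · intro k hk
    by_cases h : k = 1
    · subst h; simpa using hP1
    · simp only [h, if_false]; exact hPk k (by omega)
  · simp
  · simp only [show (2 : ℕ) ≠ 1 by norm_num, if_false]
    rw [euBeta_two _ hc, one_mul, hq]
  · intro k hk
    simp only [show k ≠ 1 by omega, if_false, show (2 : ℕ) ≠ 1 by norm_num]
    rw [euBeta_two _ hc, one_mul]
end

section
/- Let l ≥ 2 be an integer and 0 < p < 1. For k ≥ 1 and t ≥ l set I_k(t) = p(l−1)/l + (1−p)(2t−k)/(2t) and L_{k−1}(t) = p/l + (1−p)(k−1)/(2t). Let q(t,m,k) (t ≥ l, 1 ≤ m ≤ l, k ≥ 1) be real numbers satisfying: q(t,l,1) = 1 and q(t,l,k) = 0 for all k ≥ 2 and all t ≥ l; q(l,m,1) = 1 and q(l,m,k) = 0 for all k ≥ 2 and all 1 ≤ m ≤ l; and for all t ≥ l and 1 ≤ m < l: q(t+1,m,1) = I_1(t)·q(t,m+1,1), and for k ≥ 2, q(t+1,m,k) = I_k(t)·q(t,m+1,k)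 + L_{k−1}(t)·q(t,m+1,k−1). Let N : ℕ → ℕ → ℝ satisfy N(1,l) = l, N(l,l) = 1, N(k,l) = 0 for all other k, and for all t ≥ l: N(1,t+1) = N(1,t) + 1 − (p/l)·Σ_{m=1}^{l} q(t,m,1) − (1−p)·N(1,t)/(2t), and for k ≥ 2: N(k,t+1) = N(k,t) + (p/l)·(Σ_{m=1}^{l} q(t,m,k−1) − Σ_{m=1}^{l} q(t,m,k)) + ((1−p)/(2t))·((k−1)N(k−1,t) − k·N(k,t)). Then for every k ≥ 1 the limit P(k) = lim_{t→∞} N(k,t)/t exists and satisfies: P(1) = (2/(3−p))·(1−p/l)^l; for 2 ≤ k ≤ l+1, P(k) = (2/(2+k(1−p)))·((p/l)·(H_{k−1} − H_k) + ((1−p)(k−1)/2)·P(k−1)); and for k > l+1, P(k) = (B(k, l+2+2/(1−p)) / B(l+1, k+1+2/(1−p)))·P(l+1); where H_k = (p/l)^{k−1}·Σ_{m=1}^{l−(k−1)} C(l−m, l−m−(k−1))·(1−p/l)^{l−m−(k−1)} for 1 ≤ k ≤ l, and H_k = 0 for k > l. -/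
open Filter Finset

/-- The quantity `H_k` of the UPA model with window size `l`:
`H_k = (p/l)^{k-1} Σ_{m=1}^{l-(k-1)} C(l-m, l-m-(k-1)) (1-p/l)^{l-m-(k-1)}` for `1 ≤ k ≤ l`,
and `H_k = 0` for `k > l`. -/
noncomputable def Hupa (l : ℕ) (p : ℝ) (k : ℕ) : ℝ :=
  if k ≤ l then
    (p / l) ^ (k - 1) *
      ∑ m ∈ Finset.Icc 1 (l - (k - 1)),
        ((l - m).choose (l - m - (k - 1)) : ℝ) * (1 - p / l) ^ (l - m - (k - 1))
  else 0

theorem upa_rec_limit (x b : ℕ → ℝ) (a β : ℝ) (T₀ : ℕ) (ha : 0 < a)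
    (hb : Tendsto b atTop (nhds β))
    (hx : ∀ t : ℕ, T₀ ≤ t → x (t + 1) = x t * (1 - a / t) + b t) :
    Tendsto (fun t : ℕ => x t / t) atTop (nhds (β / (1 + a))) := by
  set L := β / (1 + a) with hL
  have hLa : L * (1 + a) = β := by rw [hL]; field_simp
  have he : Tendsto (fun t => |b t - β|) atTop (nhds 0) := by
    have := (hb.sub_const β).abs
    simpa using this
  have hces := he.cesaro
  obtain ⟨T₁, hT₁⟩ := exists_nat_ge a
  set T := max (max T₀ T₁) 1 with hT
  have hT1 : 1 ≤ T := le_max_right _ _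
  have hT0 : T₀ ≤ T := le_trans (le_max_left _ _) (le_max_left _ _)
  have hTa : a ≤ T := hT₁.trans (by exact_mod_cast le_trans (le_max_right _ _) (le_max_left _ _))
  have hbound : ∀ t, T ≤ t →
      |x t - L * t| ≤ |x T - L * T| + ∑ i ∈ Finset.range t, |b i - β| := by
    intro t ht
    induction t, ht using Nat.le_induction with
    | base =>
      have : 0 ≤ ∑ i ∈ Finset.range T, |b i - β| := Finset.sum_nonneg fun i _ => abs_nonneg _
      linarith
    | succ t ht ih =>
      rw [Finset.sum_range_succ]
      have htpos : (0 : ℝ) < t := by exact_mod_cast (by omega : 0 < t)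
      have hat : a / t ≤ 1 := by
        rw [div_le_one htpos]
        exact hTa.trans (by exact_mod_cast ht)
      have hat0 : 0 ≤ a / t := by positivity
      have e1 : x (t + 1) - L * ((t + 1 : ℕ) : ℝ) = (x t - L * t) * (1 - a / t) + (b t - β) := by
        rw [hx t (hT0.trans ht), ← hLa]
        push_cast
        field_simp
        ring
      rw [e1]
      have e2 : |(x t - L * t) * (1 - a / t)| ≤ |x t - L * t| := by
        rw [abs_mul]
        have : |1 - a / t| ≤ 1 := by rw [abs_le]; constructor <;> linarith
        nlinarith [abs_nonneg (x t - L * t)]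
      have := abs_add_le ((x t - L * t) * (1 - a / t)) (b t - β)
      linarith
  have h0 : Tendsto (fun t : ℕ => |x T - L * T| / (t : ℝ) +
      (t : ℝ)⁻¹ * ∑ i ∈ Finset.range t, |b i - β|) atTop (nhds 0) := by
    have := (tendsto_const_div_atTop_nhds_zero_nat (|x T - L * T|)).add hces
    simpa using this
  rw [tendsto_iff_norm_sub_tendsto_zero]
  refine squeeze_zero' (Eventually.of_forall fun _ => norm_nonneg _) ?_ h0
  filter_upwards [eventually_ge_atTop T] with t ht
  have htpos : (0 : ℝ) < t := by exact_mod_cast (by omega : 0 < t)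
  have e : x t / t - L = (x t - L * t) / t := by field_simp
  rw [e, Real.norm_eq_abs, abs_div, abs_of_pos htpos, ← div_eq_inv_mul, ← add_div]
  gcongr
  exact hbound t ht

/-- limit of `q t (l - j) (k + 1)` -/
noncomputable def upaQ (r : ℝ) (j k : ℕ) : ℝ := (j.choose k : ℝ) * r ^ k * (1 - r) ^ (j - k)

theorem upaQ_succ (r : ℝ) (j k : ℕ) :
    upaQ r (j + 1) (k + 1) = (1 - r) * upaQ r j (k + 1) + r * upaQ r j k := by
  unfold upaQ
  rw [Nat.choose_succ_succ, Nat.add_sub_add_right]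
  push_cast
  rcases Nat.lt_or_ge k j with h | h
  · have : j - k = (j - (k + 1)) + 1 := by omega
    rw [this]
    ring
  · rw [Nat.choose_eq_zero_of_lt (by omega : j < k + 1)]
    push_cast
    ring

theorem upaH_eq (l : ℕ) (p : ℝ) (k : ℕ) :
    ∑ m ∈ Finset.Icc 1 l, upaQ (p / l) (l - m) k = Hupa l p (k + 1) := by
  unfold Hupa
  split_ifs with h
  · rw [Nat.add_sub_cancel, Finset.mul_sum]
    symm
    rw [← Finset.sum_subset (s₁ := Finset.Icc 1 (l - k)) (s₂ := Finset.Icc 1 l)]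
    · refine Finset.sum_congr rfl fun m hm => ?_
      rw [Finset.mem_Icc] at hm
      unfold upaQ
      rw [Nat.choose_symm (by omega : k ≤ l - m)]
      ring
    · exact Finset.Icc_subset_Icc le_rfl (by omega)
    · intro m hm hm'
      rw [Finset.mem_Icc] at hm hm'
      unfold upaQ
      rw [Nat.choose_eq_zero_of_lt (by omega)]
      simp
  · refine Finset.sum_eq_zero fun m hm => ?_
    rw [Finset.mem_Icc] at hm
    unfold upaQ
    rw [Nat.choose_eq_zero_of_lt (by omega)]
    simp

theorem upaH_one (l : ℕ) (hl : 2 ≤ l) (p : ℝ) :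
    1 - (p / l) * Hupa l p 1 = (1 - p / l) ^ l := by
  rw [← upaH_eq l p 0]
  have : ∑ m ∈ Finset.Icc 1 l, upaQ (p / l) (l - m) 0
      = ∑ i ∈ Finset.range l, (1 - p / l) ^ i := by
    refine Finset.sum_bij' (fun m _ => l - m) (fun i _ => l - i) ?_ ?_ ?_ ?_ ?_
    · intro m hm; simp only [Finset.mem_Icc, Finset.mem_range] at *; omega
    · intro m hm; simp only [Finset.mem_Icc, Finset.mem_range] at *; omega
    · intro m hm; simp only [Finset.mem_Icc] at *; omega
    · intro m hm; simp only [Finset.mem_range] at *; omega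
    · intro m hm; simp [upaQ]
  rw [this]
  have := geom_sum_mul (1 - p / (l : ℝ)) l
  linear_combination this

/-- the limiting degree distribution -/
noncomputable def upaP (l : ℕ) (p : ℝ) : ℕ → ℝ
  | 0 => 0
  | k + 1 => (2 / (2 + ((k : ℝ) + 1) * (1 - p))) *
      ((if k = 0 then 1 - (p / l) * Hupa l p 1 else (p / l) * (Hupa l p k - Hupa l p (k + 1)))
        + ((1 - p) * (k : ℝ) / 2) * upaP l p k)

theorem upa_beta_step (l : ℕ) (c : ℝ) (hc : 0 < c) (k : ℕ) (hk : 1 ≤ k) :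
    euBeta ((k + 1 : ℕ) : ℝ) ((l : ℝ) + 2 + c) / euBeta ((l : ℝ) + 1) (((k + 1 : ℕ) : ℝ) + 1 + c)
      = (k / (k + 1 + c)) * (euBeta k ((l : ℝ) + 2 + c) / euBeta ((l : ℝ) + 1) ((k : ℝ) + 1 + c)) := by
  have hk0 : (0 : ℝ) < k := by exact_mod_cast hk
  unfold euBeta
  push_cast
  have e1 : (k : ℝ) + 1 + ((l : ℝ) + 2 + c) = (l : ℝ) + 1 + ((k : ℝ) + 1 + 1 + c) := by ring
  have e2 : (k : ℝ) + ((l : ℝ) + 2 + c) = (l : ℝ) + 1 + ((k : ℝ) + 1 + c) := by ring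
  have e3 : (k : ℝ) + 1 + 1 + c = ((k : ℝ) + 1 + c) + 1 := by ring
  rw [e1, e2, e3, Real.Gamma_add_one hk0.ne', Real.Gamma_add_one (by positivity : (k : ℝ) + 1 + c ≠ 0)]
  have g1 := Real.Gamma_pos_of_pos (by positivity : (0 : ℝ) < (l : ℝ) + 1 + ((k : ℝ) + 1 + c))
  have g2 := Real.Gamma_pos_of_pos (by positivity : (0 : ℝ) < (l : ℝ) + 1 + ((k : ℝ) + 1 + c + 1))
  have g3 := Real.Gamma_pos_of_pos (by positivity : (0 : ℝ) < (l : ℝ) + 1)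
  have g4 := Real.Gamma_pos_of_pos (by positivity : (0 : ℝ) < (k : ℝ) + 1 + c)
  field_simp

theorem upa_beta_base (l : ℕ) (c : ℝ) (hc : 0 < c) :
    euBeta ((l + 1 : ℕ) : ℝ) ((l : ℝ) + 2 + c) / euBeta ((l : ℝ) + 1) (((l + 1 : ℕ) : ℝ) + 1 + c)
      = 1 := by
  unfold euBeta
  push_cast
  have e3 : (l : ℝ) + 1 + 1 + c = (l : ℝ) + 2 + c := by ring
  rw [e3]
  have g1 := Real.Gamma_pos_of_pos (by positivity : (0 : ℝ) < (l : ℝ) + 1 + ((l : ℝ) + 2 + c))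
  have g3 := Real.Gamma_pos_of_pos (by positivity : (0 : ℝ) < (l : ℝ) + 1)
  have g4 := Real.Gamma_pos_of_pos (by positivity : (0 : ℝ) < (l : ℝ) + 2 + c)
  field_simp

theorem stmt_1 (l : ℕ) (hl : 2 ≤ l) (p : ℝ) (hp0 : 0 < p) (hp1 : p < 1)
    (q : ℕ → ℕ → ℕ → ℝ) (N : ℕ → ℕ → ℝ)
    (hql1 : ∀ t : ℕ, l ≤ t → q t l 1 = 1)
    (hqlk : ∀ t : ℕ, l ≤ t → ∀ k : ℕ, 2 ≤ k → q t l k = 0)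
    (hqinit1 : ∀ m : ℕ, 1 ≤ m → m ≤ l → q l m 1 = 1)
    (hqinitk : ∀ m : ℕ, 1 ≤ m → m ≤ l → ∀ k : ℕ, 2 ≤ k → q l m k = 0)
    (hqrec1 : ∀ t : ℕ, l ≤ t → ∀ m : ℕ, 1 ≤ m → m < l →
      q (t + 1) m 1 = (p * ((l : ℝ) - 1) / l + (1 - p) * (2 * t - 1) / (2 * t)) * q t (m + 1) 1)
    (hqreck : ∀ t : ℕ, l ≤ t → ∀ m : ℕ, 1 ≤ m → m < l → ∀ k : ℕ, 2 ≤ k →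
      q (t + 1) m k
        = (p * ((l : ℝ) - 1) / l + (1 - p) * (2 * t - k) / (2 * t)) * q t (m + 1) k
          + (p / l + (1 - p) * ((k : ℝ) - 1) / (2 * t)) * q t (m + 1) (k - 1))
    (hN1 : N 1 l = l)
    (hNl : N l l = 1)
    (hN0 : ∀ k : ℕ, k ≠ 1 → k ≠ l → N k l = 0)
    (hNrec1 : ∀ t : ℕ, l ≤ t →
      N 1 (t + 1) = N 1 t + 1 - (p / l) * (∑ m ∈ Finset.Icc 1 l, q t m 1)
        - (1 - p) * N 1 t / (2 * t))
    (hNreck : ∀ t : ℕ, l ≤ t → ∀ k : ℕ, 2 ≤ k →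
      N k (t + 1) = N k t
        + (p / l) * ((∑ m ∈ Finset.Icc 1 l, q t m (k - 1)) - ∑ m ∈ Finset.Icc 1 l, q t m k)
        + ((1 - p) / (2 * t)) * (((k : ℝ) - 1) * N (k - 1) t - k * N k t)) :
    ∃ P : ℕ → ℝ,
      (∀ k : ℕ, 1 ≤ k → Tendsto (fun t : ℕ => N k t / t) atTop (nhds (P k))) ∧
      P 1 = (2 / (3 - p)) * (1 - p / l) ^ l ∧
      (∀ k : ℕ, 2 ≤ k → k ≤ l + 1 →
        P k = (2 / (2 + k * (1 - p))) *
          ((p / l) * (Hupa l p (k - 1) - Hupa l p k) + ((1 - p) * ((k : ℝ) - 1) / 2) * P (k - 1))) ∧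
      (∀ k : ℕ, l + 1 < k →
        P k = (euBeta k ((l : ℝ) + 2 + 2 / (1 - p))
          / euBeta ((l : ℝ) + 1) ((k : ℝ) + 1 + 2 / (1 - p))) * P (l + 1)) := by
  have hl0 : (0 : ℝ) < l := by exact_mod_cast (by omega : 0 < l)
  -- limits of the coefficients
  have hI : ∀ k : ℝ, Tendsto
      (fun t : ℕ => p * ((l : ℝ) - 1) / l + (1 - p) * (2 * t - k) / (2 * t)) atTop
      (nhds (1 - p / l)) := by
    intro k
    have h := (tendsto_const_div_atTop_nhds_zero_nat ((1 - p) * k / 2)).const_sub (1 - p / l)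
    rw [sub_zero] at h
    refine h.congr' ?_
    filter_upwards [eventually_ge_atTop 1] with t ht
    have htpos : (0 : ℝ) < t := by exact_mod_cast ht
    field_simp
    ring
  have hLc : ∀ k : ℝ, Tendsto
      (fun t : ℕ => p / l + (1 - p) * k / (2 * t)) atTop (nhds (p / l)) := by
    intro k
    have h := (tendsto_const_div_atTop_nhds_zero_nat ((1 - p) * k / 2)).const_add (p / l)
    rw [add_zero] at h
    refine h.congr' ?_
    filter_upwards [eventually_ge_atTop 1] with t ht
    have htpos : (0 : ℝ) < t := by exact_mod_cast ht
    field_simp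
  have hq : ∀ j : ℕ, j < l → ∀ k : ℕ,
      Tendsto (fun t => q t (l - j) (k + 1)) atTop (nhds (upaQ (p / l) j k)) := by
    intro j
    induction j with
    | zero =>
      intro _ k
      refine tendsto_const_nhds.congr' ?_
      filter_upwards [eventually_ge_atTop l] with t ht
      rcases k with _ | k
      · simp [upaQ, hql1 t ht]
      · simp [upaQ, hqlk t ht (k + 1 + 1) (by omega)]
    | succ j ih =>
      intro hj k
      have ih' := ih (by omega)
      have hm : l - (j + 1) + 1 = l - j := by omega
      rw [← tendsto_add_atTop_iff_nat 1]
      rcases k with _ | k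
      · have h := (hI 1).mul (ih' 0)
        have e : (1 - p / l) * upaQ (p / l) j 0 = upaQ (p / l) (j + 1) 0 := by
          simp [upaQ]; ring
        rw [e] at h
        refine h.congr' ?_
        filter_upwards [eventually_ge_atTop l] with t ht
        have := hqrec1 t ht (l - (j + 1)) (by omega) (by omega)
        rw [hm] at this
        exact this.symm
      · have h := ((hI ((k + 1 + 1 : ℕ) : ℝ)).mul (ih' (k + 1))).add
          ((hLc (((k + 1 + 1 : ℕ) : ℝ) - 1)).mul (ih' k))
        rw [← upaQ_succ] at h
        refine h.congr' ?_
        filter_upwards [eventually_ge_atTop l] with t ht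
        have := hqreck t ht (l - (j + 1)) (by omega) (by omega) (k + 1 + 1) (by omega)
        rw [hm] at this
        exact this.symm
  have hS : ∀ k : ℕ, Tendsto (fun t => ∑ m ∈ Finset.Icc 1 l, q t m (k + 1)) atTop
      (nhds (Hupa l p (k + 1))) := by
    intro k
    rw [← upaH_eq]
    refine tendsto_finset_sum _ fun m hm => ?_
    rw [Finset.mem_Icc] at hm
    have := hq (l - m) (by omega) k
    rwa [show l - (l - m) = m by omega] at this
  have hp1' : 0 < 1 - p := by linarith
  have hlim : ∀ k : ℕ, Tendsto (fun t : ℕ => N (k + 1) t / t) atTop (nhds (upaP l p (k + 1))) := by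
    intro k
    induction k with
    | zero =>
      have h := upa_rec_limit (N 1) (fun t => 1 - (p / l) * (∑ m ∈ Finset.Icc 1 l, q t m 1))
        ((1 - p) / 2) (1 - (p / l) * Hupa l p 1) l (by linarith)
        (((hS 0).const_mul (p / l)).const_sub 1) ?_
      · convert h using 2
        simp only [upaP]
        simp
        field_simp
      · intro t ht
        rw [hNrec1 t ht]
        have htpos : (0 : ℝ) < t := by exact_mod_cast (by omega : 0 < t)
        field_simp
        ring
    | succ k ih =>
      have hb : Tendsto (fun t : ℕ => (p / l) * ((∑ m ∈ Finset.Icc 1 l, q t m (k + 1))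
          - ∑ m ∈ Finset.Icc 1 l, q t m (k + 1 + 1))
          + ((1 - p) * ((k : ℝ) + 1) / 2) * (N (k + 1) t / t)) atTop
          (nhds ((p / l) * (Hupa l p (k + 1) - Hupa l p (k + 1 + 1))
            + ((1 - p) * ((k : ℝ) + 1) / 2) * upaP l p (k + 1))) :=
        (((hS k).sub (hS (k + 1))).const_mul _).add (ih.const_mul _)
      have h := upa_rec_limit (N (k + 1 + 1)) _ ((1 - p) * ((k : ℝ) + 1 + 1) / 2) _ l
        (by positivity) hb ?_
      · convert h using 2
        rw [upaP, if_neg (by omega)]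
        push_cast
        field_simp
      · intro t ht
        rw [hNreck t ht (k + 1 + 1) (by omega)]
        have htpos : (0 : ℝ) < t := by exact_mod_cast (by omega : 0 < t)
        rw [Nat.add_sub_cancel]
        push_cast
        field_simp
        ring
  have hrec : ∀ k : ℕ, 2 ≤ k → upaP l p k = (2 / (2 + k * (1 - p))) *
      ((p / l) * (Hupa l p (k - 1) - Hupa l p k)
        + ((1 - p) * ((k : ℝ) - 1) / 2) * upaP l p (k - 1)) := by
    intro k hk
    obtain ⟨j, rfl⟩ : ∃ j, k = j + 1 := ⟨k - 1, by omega⟩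
    rw [upaP, if_neg (by omega), Nat.add_sub_cancel]
    push_cast
    rw [add_sub_cancel_right]
  refine ⟨upaP l p, ?_, ?_, fun k hk _ => hrec k hk, ?_⟩
  · intro k hk
    obtain ⟨j, rfl⟩ : ∃ j, k = j + 1 := ⟨k - 1, by omega⟩
    exact hlim j
  · rw [← upaH_one l hl p]
    simp only [upaP]
    simp
    left
    ring
  · have hc : 0 < 2 / (1 - p) := by positivity
    have key : ∀ k : ℕ, l + 1 ≤ k →
        upaP l p k = (euBeta k ((l : ℝ) + 2 + 2 / (1 - p))
          / euBeta ((l : ℝ) + 1) ((k : ℝ) + 1 + 2 / (1 - p))) * upaP l p (l + 1) := by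
      intro k hk
      induction k, hk using Nat.le_induction with
      | base => rw [upa_beta_base l _ hc, one_mul]
      | succ k hk ih =>
        rw [upa_beta_step l _ hc k (by omega), mul_assoc, ← ih, hrec (k + 1) (by omega),
          Nat.add_sub_cancel]
        have z1 : Hupa l p k = 0 := by unfold Hupa; rw [if_neg (by omega)]
        have z2 : Hupa l p (k + 1) = 0 := by unfold Hupa; rw [if_neg (by omega)]
        rw [z1, z2]
        push_cast
        field_simp
        ring
    exact fun k hk => key k hk.le
end

section
/- Let 0 ≤ p ≤ 1 and let n : ℕ → ℝ satisfy n(1) = 2 and, for all integers t ≥ 1, n(t+1) = (1 − (1−p)/(2t))·n(t) + (1−p). Then lim_{t→∞} n(t)/t = 2(1−p)/(3−p). -/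
open Filter

theorem stmt_2 (p : ℝ) (hp0 : 0 ≤ p) (hp1 : p ≤ 1) (n : ℕ → ℝ)
    (hinit : n 1 = 2)
    (hrec : ∀ t : ℕ, 1 ≤ t → n (t + 1) = (1 - (1 - p) / (2 * t)) * n t + (1 - p)) :
    Tendsto (fun t : ℕ => n t / t) atTop (nhds (2 * (1 - p) / (3 - p))) := by
  obtain ⟨c, hc⟩ : ∃ c, c = 2 * (1 - p) / (3 - p) := ⟨_, rfl⟩
  rw [← hc]
  have hc' : c * (3 - p) = 2 * (1 - p) := by
    rw [hc]; exact div_mul_cancel₀ _ (by linarith)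
  have hb : ∀ t : ℕ, 1 ≤ t → |n t - c * t| ≤ |2 - c| := by
    intro t ht
    induction t, ht using Nat.le_induction with
    | base => simp [hinit]
    | succ t ht ih =>
      have ht' : (1 : ℝ) ≤ t := by exact_mod_cast ht
      have h1 : n (t + 1) - c * ((t + 1 : ℕ) : ℝ)
          = (1 - (1 - p) / (2 * t)) * (n t - c * t) := by
        rw [hrec t ht]
        have : (1 - p) / (2 * t) * (c * t) = (1 - p) * c / 2 := by
          field_simp
        push_cast
        linear_combination (-1 / 2) * hc' - this
      have h2 : 0 ≤ (1 - p) / (2 * t) := div_nonneg (by linarith) (by linarith)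
      have h3 : (1 - p) / (2 * t) ≤ 1 := by
        rw [div_le_one (by linarith)]; linarith
      rw [h1, abs_mul]
      have h4 : |1 - (1 - p) / (2 * t)| ≤ 1 := by
        rw [abs_le]; constructor <;> linarith
      exact (mul_le_of_le_one_left (abs_nonneg _) h4).trans ih
  rw [tendsto_iff_norm_sub_tendsto_zero]
  refine squeeze_zero' (Eventually.of_forall fun _ => norm_nonneg _) ?_
    (tendsto_const_div_atTop_nhds_zero_nat |2 - c|)
  filter_upwards [eventually_ge_atTop 1] with t ht
  have ht' : (0 : ℝ) < t := by exact_mod_cast ht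
  have : n t / t - c = (n t - c * t) / t := by field_simp
  rw [this, Real.norm_eq_abs, abs_div, abs_of_pos ht']
  exact div_le_div_of_nonneg_right (hb t ht) ht'.le
end

section
/- Let 0 ≤ p < 1, let P₁ ∈ ℝ, and let n₁, n₂ : ℕ → ℝ be sequences with n₁(t) ≥ 0 and n₂(t) ≥ 0 for all t ≥ 1, such that lim_{t→∞} n₁(t)/t = P₁ and, for all integers t ≥ 1, n₂(t+1) = (1 − (1−p)/t)·n₂(t) + ((1−p)/(2t))·n₁(t) + p. Then lim_{t→∞} n₂(t)/t = (1/(2−p))·(((1−p)/2)·P₁ + p). -/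
open Filter

theorem stmt_3 (p : ℝ) (hp0 : 0 ≤ p) (hp1 : p < 1) (P₁ : ℝ) (n₁ n₂ : ℕ → ℝ)
    (hn₁pos : ∀ t : ℕ, 1 ≤ t → 0 ≤ n₁ t) (hn₂pos : ∀ t : ℕ, 1 ≤ t → 0 ≤ n₂ t)
    (hlim : Tendsto (fun t : ℕ => n₁ t / t) atTop (nhds P₁))
    (hrec : ∀ t : ℕ, 1 ≤ t →
      n₂ (t + 1) = (1 - (1 - p) / t) * n₂ t + ((1 - p) / (2 * t)) * n₁ t + p) :
    Tendsto (fun t : ℕ => n₂ t / t) atTop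
      (nhds ((1 / (2 - p)) * (((1 - p) / 2) * P₁ + p))) := by
  set L : ℝ := (1 / (2 - p)) * (((1 - p) / 2) * P₁ + p) with hL
  have hLeq : (2 - p) * L = ((1 - p) / 2) * P₁ + p := by
    have : (2 - p) ≠ 0 := by linarith
    rw [hL]; field_simp
  let e : ℕ → ℝ := fun t => |((1 - p) / 2) * (n₁ t / t - P₁)|
  have he : Tendsto e atTop (nhds 0) := by
    have h := ((hlim.sub_const P₁).const_mul ((1 - p) / 2)).abs
    rw [sub_self, mul_zero, abs_zero] at h
    exact h
  have hces := he.cesaro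
  have hb : ∀ t : ℕ, 1 ≤ t →
      |n₂ t - L * t| ≤ |n₂ 1 - L| + ∑ i ∈ Finset.range t, e i := by
    intro t ht
    induction t, ht using Nat.le_induction with
    | base =>
      have : 0 ≤ e 0 := abs_nonneg _
      simpa using this
    | succ t ht ih =>
      have ht' : (1 : ℝ) ≤ t := by exact_mod_cast ht
      have ht0 : (t : ℝ) ≠ 0 := by positivity
      have hstep : n₂ (t + 1) - L * ((t + 1 : ℕ) : ℝ)
          = (1 - (1 - p) / t) * (n₂ t - L * t) + ((1 - p) / 2) * (n₁ t / t - P₁) := by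
        rw [hrec t ht]
        push_cast
        field_simp
        linear_combination (-2 * (t : ℝ)) * hLeq
      have h1 : (1 - p) / t ≤ 1 := by
        rw [div_le_one (by positivity)]; linarith
      have h2 : 0 ≤ (1 - p) / t := div_nonneg (by linarith) (by positivity)
      have h3 : |(1 - (1 - p) / t) * (n₂ t - L * t)| ≤ |n₂ t - L * t| := by
        rw [abs_mul, abs_of_nonneg (by linarith : 0 ≤ 1 - (1 - p) / (t : ℝ))]
        exact mul_le_of_le_one_left (abs_nonneg _) (by linarith)
      rw [hstep, Finset.sum_range_succ]
      have h4 := abs_add_le ((1 - (1 - p) / t) * (n₂ t - L * t))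
        (((1 - p) / 2) * (n₁ t / t - P₁))
      have h5 : e t = |((1 - p) / 2) * (n₁ t / t - P₁)| := rfl
      linarith
  have hbound : Tendsto (fun t : ℕ => |n₂ 1 - L| / (t : ℝ)
      + (t : ℝ)⁻¹ * ∑ i ∈ Finset.range t, e i) atTop (nhds 0) := by
    simpa using (tendsto_const_div_atTop_nhds_zero_nat |n₂ 1 - L|).add hces
  rw [tendsto_iff_norm_sub_tendsto_zero]
  refine squeeze_zero' (Eventually.of_forall fun _ => norm_nonneg _) ?_ hbound
  filter_upwards [eventually_ge_atTop 1] with t ht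
  have ht0 : (0 : ℝ) < t := by exact_mod_cast ht
  have h : n₂ t / t - L = (n₂ t - L * t) / t := by field_simp
  rw [Real.norm_eq_abs, h, abs_div, abs_of_pos ht0, inv_mul_eq_div, ← add_div]
  exact div_le_div_of_nonneg_right (hb t ht) ht0.le
end

section
/- Let 0 ≤ p < 1, let k > 2 be an integer, let P_{k−1} ∈ ℝ, and let n_{k−1}, n_k : ℕ → ℝ be sequences with n_{k−1}(t) ≥ 0 and n_k(t) ≥ 0 for all t ≥ 1, such that lim_{t→∞} n_{k−1}(t)/t = P_{k−1} and, for all integers t ≥ 1, n_k(t+1) = (1 − (1−p)k/(2t))·n_k(t) + ((1−p)(k−1)/(2t))·n_{k−1}(t). Then lim_{t→∞} n_k(t)/t = ((1−p)(k−1)/(2+(1−p)k))·P_{k−1}. -/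
open Filter

theorem stmt_4 (p : ℝ) (hp0 : 0 ≤ p) (hp1 : p < 1) (k : ℕ) (hk : 2 < k)
    (Pkm : ℝ) (nkm nk : ℕ → ℝ)
    (hnkmpos : ∀ t : ℕ, 1 ≤ t → 0 ≤ nkm t) (hnkpos : ∀ t : ℕ, 1 ≤ t → 0 ≤ nk t)
    (hlim : Tendsto (fun t : ℕ => nkm t / t) atTop (nhds Pkm))
    (hrec : ∀ t : ℕ, 1 ≤ t →
      nk (t + 1) = (1 - (1 - p) * k / (2 * t)) * nk t
        + ((1 - p) * ((k : ℝ) - 1) / (2 * t)) * nkm t) :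
    Tendsto (fun t : ℕ => nk t / t) atTop
      (nhds (((1 - p) * ((k : ℝ) - 1) / (2 + (1 - p) * k)) * Pkm)) := by
  have hb : 0 ≤ (1 - p) * (k : ℝ) := mul_nonneg (by linarith) (by positivity)
  set b : ℝ := (1 - p) * (k : ℝ) with hbdef
  set a : ℝ := (1 - p) * ((k : ℝ) - 1) with ha
  set L : ℝ := a / (2 + b) * Pkm with hL
  have hLb : L * (2 + b) = a * Pkm := by
    rw [hL]; field_simp
  let e : ℕ → ℝ := fun t => a / 2 * (nkm t / t) - a / 2 * Pkm
  have he : Tendsto (fun t => |e t|) atTop (nhds 0) := by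
    have h1 : Tendsto e atTop (nhds (a / 2 * Pkm - a / 2 * Pkm)) :=
      (hlim.const_mul (a / 2)).sub_const _
    rw [sub_self] at h1
    simpa using h1.abs
  let y : ℕ → ℝ := fun t => nk t - L * t
  obtain ⟨T, hT⟩ := exists_nat_ge (b + 1)
  have hT1 : (1 : ℝ) ≤ T := by linarith
  have hstep : ∀ t : ℕ, T ≤ t → |y (t + 1)| ≤ |y t| + |e t| := by
    intro t ht
    have htT : (T : ℝ) ≤ t := by exact_mod_cast ht
    have ht1 : (1 : ℝ) ≤ t := by linarith
    have ht0 : (0 : ℝ) < t := by linarith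
    have hy : y (t + 1) = (1 - b / (2 * t)) * y t + e t := by
      simp only [y, e]
      rw [hrec t (by exact_mod_cast ht1)]
      push_cast
      field_simp
      linear_combination (-(t : ℝ)) * hLb
    have h2 : b / (2 * t) ≤ 1 := by
      rw [div_le_one (by positivity)]; linarith
    have h3 : 0 ≤ b / (2 * t) := by positivity
    have h4 : |1 - b / (2 * t)| ≤ 1 := by rw [abs_le]; constructor <;> linarith
    rw [hy]
    refine (abs_add_le _ _).trans ?_
    rw [abs_mul]
    have := mul_le_mul_of_nonneg_right h4 (abs_nonneg (y t))
    linarith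
  have hbound : ∀ t : ℕ, T ≤ t → |y t| ≤ |y T| + ∑ i ∈ Finset.range t, |e i| := by
    intro t ht
    induction t, ht using Nat.le_induction with
    | base =>
      have : 0 ≤ ∑ i ∈ Finset.range T, |e i| := Finset.sum_nonneg fun i _ => abs_nonneg _
      linarith
    | succ t ht ih =>
      rw [Finset.sum_range_succ]
      have := hstep t ht
      linarith
  have hlim2 : Tendsto (fun t : ℕ => |y T| / (t : ℝ) + (t : ℝ)⁻¹ * ∑ i ∈ Finset.range t, |e i|)
      atTop (nhds 0) := by
    simpa using (tendsto_const_div_atTop_nhds_zero_nat |y T|).add he.cesaro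
  rw [tendsto_iff_norm_sub_tendsto_zero]
  refine squeeze_zero' (Eventually.of_forall fun t => norm_nonneg _) ?_ hlim2
  filter_upwards [eventually_ge_atTop T] with t ht
  have htT : (T : ℝ) ≤ t := by exact_mod_cast ht
  have ht0 : (0 : ℝ) < t := by linarith
  have h5 : nk t / t - L = y t / t := by
    simp only [y]; field_simp
  rw [h5, Real.norm_eq_abs, abs_div, abs_of_pos ht0]
  calc |y t| / t ≤ (|y T| + ∑ i ∈ Finset.range t, |e i|) / t := by
        gcongr; exact hbound t ht
    _ = _ := by rw [add_div, div_eq_inv_mul (∑ i ∈ Finset.range t, |e i|)]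
end

section
/- Let 0 ≤ p < 1 and let P : ℕ → ℝ satisfy P(k) = ((1−p)(k−1)/(2+(1−p)k))·P(k−1) for every integer k ≥ 3. Then for every integer k > 2, P(k) = (2/(1−p)+2)·(2/(1−p)+1)·B(k, 1+2/(1−p))·P(2), where B denotes the Euler Beta function. -/
theorem stmt_5 (p : ℝ) (hp0 : 0 ≤ p) (hp1 : p < 1) (P : ℕ → ℝ)
    (hrec : ∀ k : ℕ, 3 ≤ k →
      P k = ((1 - p) * ((k : ℝ) - 1) / (2 + (1 - p) * k)) * P (k - 1)) :
    ∀ k : ℕ, 2 < k →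
      P k = (2 / (1 - p) + 2) * (2 / (1 - p) + 1) * euBeta k (1 + 2 / (1 - p)) * P 2 := by
  have hq : 0 < 1 - p := by linarith
  have key : ∀ a : ℝ, 0 < a → ∀ n : ℕ,
      euBeta ((n + 2 : ℕ) + 1) (1 + a) =
        ((n + 2 : ℕ) : ℝ) / ((n + 2 : ℕ) + 1 + a) * euBeta ((n + 2 : ℕ)) (1 + a) := by
    intro a ha n
    have hn : (0 : ℝ) < ((n + 2 : ℕ) : ℝ) := by positivity
    generalize ((n + 2 : ℕ) : ℝ) = x at hn
    unfold euBeta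
    have h1 : x + 1 + (1 + a) = (x + (1 + a)) + 1 := by ring
    rw [h1, Real.Gamma_add_one hn.ne', Real.Gamma_add_one (by positivity)]
    have hg : Real.Gamma (x + (1 + a)) ≠ 0 := (Real.Gamma_pos_of_pos (by positivity)).ne'
    have h2 : x + (1 + a) ≠ 0 := by positivity
    have h3 : x + 1 + a = x + (1 + a) := by ring
    rw [h3]
    field_simp
  have base : ∀ a : ℝ, 0 < a → (a + 2) * (a + 1) * euBeta 2 (1 + a) = 1 := by
    intro a ha
    unfold euBeta
    have h1 : (2 : ℝ) + (1 + a) = ((1 + a) + 1) + 1 := by ring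
    rw [h1, Real.Gamma_add_one (by positivity), Real.Gamma_add_one (by positivity),
      Real.Gamma_two]
    have hg : Real.Gamma (1 + a) ≠ 0 := (Real.Gamma_pos_of_pos (by positivity)).ne'
    have h2 : 1 + a ≠ 0 := by positivity
    have h3 : 1 + a + 1 ≠ 0 := by positivity
    field_simp
    ring
  have ha : 0 < 2 / (1 - p) := by positivity
  have main : ∀ n : ℕ, P (n + 2) =
      (2 / (1 - p) + 2) * (2 / (1 - p) + 1) * euBeta ((n + 2 : ℕ)) (1 + 2 / (1 - p)) * P 2 := by
    intro n
    induction n with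
    | zero =>
      have := base _ ha
      simp only [zero_add, Nat.cast_ofNat]
      rw [this, one_mul]
    | succ n ih =>
      have hr := hrec (n + 2 + 1) (by omega)
      have hk := key _ ha n
      have e : n + 1 + 2 = n + 2 + 1 := by ring
      rw [e, hr, Nat.add_sub_cancel, ih, Nat.cast_add_one, hk]
      have hc : (1 - p) * (((n + 2 : ℕ) : ℝ) + 1 - 1) / (2 + (1 - p) * (((n + 2 : ℕ) : ℝ) + 1))
          = ((n + 2 : ℕ) : ℝ) / ((n + 2 : ℕ) + 1 + 2 / (1 - p)) := by
        have hn : (0 : ℝ) < ((n + 2 : ℕ) : ℝ) := by positivity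
        generalize ((n + 2 : ℕ) : ℝ) = x at hn
        have h1 : 2 + (1 - p) * (x + 1) ≠ 0 := by positivity
        have h2 : x + 1 + 2 / (1 - p) ≠ 0 := by positivity
        rw [div_eq_div_iff h1 h2]
        field_simp
        ring
      rw [hc]
      ring
  intro k hk
  obtain ⟨n, rfl⟩ : ∃ n, k = n + 2 := ⟨k - 2, by omega⟩
  exact main n
end

section
/- Let 0 ≤ p < 1 and let P : ℕ → ℝ satisfy, for every integer k > 2, P(k) = (2/(1−p)+2)·(2/(1−p)+1)·B(k, 1+2/(1−p))·P(2), where B denotes the Euler Beta function. Then lim_{k→∞} k^{1+2/(1−p)}·P(k) = C_p, where C_p = Γ(1+2/(1−p))·(2/(1−p)+2)·(2/(1−p)+1)·P(2). -/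
open Filter

theorem aux_prod (s : ℝ) (hs : 0 < s) (n : ℕ) :
    Real.Gamma (s + n) = (∏ j ∈ Finset.range n, (s + j)) * Real.Gamma s := by
  induction n with
  | zero => simp
  | succ n ih =>
    rw [Finset.prod_range_succ, Nat.cast_succ, ← add_assoc,
      Real.Gamma_add_one (by positivity), ih]
    ring

theorem aux_beta (s : ℝ) (hs : 0 < s) (k : ℕ) (hk : 0 < k) :
    (k : ℝ) ^ s * euBeta k s = Real.GammaSeq s k * (1 + s / k) := by
  have hk' : (0 : ℝ) < k := by exact_mod_cast hk
  have hG := Real.Gamma_pos_of_pos hs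
  have hpr : 0 < ∏ j ∈ Finset.range k, (s + (j : ℝ)) :=
    Finset.prod_pos (fun j _ => by positivity)
  have hf : (k.factorial : ℝ) = k * Real.Gamma k := by
    rw [← Real.Gamma_add_one hk'.ne', Real.Gamma_nat_eq_factorial]
  have hsk : s + k ≠ 0 := by positivity
  unfold euBeta Real.GammaSeq
  rw [add_comm (k : ℝ) s, aux_prod s hs, Finset.prod_range_succ, hf]
  field_simp
  ring

theorem stmt_6 (p : ℝ) (hp0 : 0 ≤ p) (hp1 : p < 1) (P : ℕ → ℝ)
    (hP : ∀ k : ℕ, 2 < k →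
      P k = (2 / (1 - p) + 2) * (2 / (1 - p) + 1) * euBeta k (1 + 2 / (1 - p)) * P 2) :
    Tendsto (fun k : ℕ => (k : ℝ) ^ (1 + 2 / (1 - p)) * P k) atTop
      (nhds (Real.Gamma (1 + 2 / (1 - p)) * (2 / (1 - p) + 2) * (2 / (1 - p) + 1) * P 2)) := by
  have hs : 0 < 1 + 2 / (1 - p) := by
    have : 0 < 1 - p := by linarith
    positivity
  generalize 1 + 2 / (1 - p) = s at *
  have h1 : Tendsto (fun k : ℕ => 1 + s / (k : ℝ)) atTop (nhds (1 + 0)) :=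
    tendsto_const_nhds.add (tendsto_const_div_atTop_nhds_zero_nat s)
  have h2 := ((Real.GammaSeq_tendsto_Gamma s).mul h1).mul_const
    ((2 / (1 - p) + 2) * (2 / (1 - p) + 1) * P 2)
  have e : Real.Gamma s * (2 / (1 - p) + 2) * (2 / (1 - p) + 1) * P 2 =
      Real.Gamma s * (1 + 0) * ((2 / (1 - p) + 2) * (2 / (1 - p) + 1) * P 2) := by ring
  rw [e]
  refine h2.congr' ?_
  filter_upwards [eventually_gt_atTop 2] with k hk
  rw [hP k hk, ← aux_beta s hs k (by omega)]
  ring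
end

section
/- Let 0 ≤ p < 1 and let P : ℕ → ℝ satisfy, for every integer k > 2, P(k) = (2/(1−p)+2)·(2/(1−p)+1)·B(k, 1+2/(1−p))·P(2), where B denotes the Euler Beta function, and set C_p = Γ(1+2/(1−p))·(2/(1−p)+2)·(2/(1−p)+1)·P(2). Then lim_{k→∞} k^{2+2/(1−p)}·(P(k) − C_p·k^{−(1+2/(1−p))}) = −C_p·(3−p)/(1−p)². -/
open Filter

/-- One-sided half of the `0/0` Stolz–Cesàro theorem against `1/n`. -/
lemma stolz_half (u : ℕ → ℝ) (M : ℝ) (hu : Tendsto u atTop (nhds 0))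
    (h : ∀ᶠ n : ℕ in atTop, (n : ℝ) * (n + 1) * (u (n + 1) - u n) ≤ M) :
    ∀ᶠ n : ℕ in atTop, -M ≤ n * u n := by
  obtain ⟨N, hN⟩ := eventually_atTop.1 h
  have hv : Tendsto (fun n : ℕ => u n + M / n) atTop (nhds 0) := by
    simpa using hu.add (tendsto_const_div_atTop_nhds_zero_nat M)
  refine eventually_atTop.2 ⟨N + 1, fun n hn => ?_⟩
  have hn0 : (0 : ℝ) < n := by exact_mod_cast (by omega : 0 < n)
  have hanti : Antitone (fun j : ℕ => u (n + j) + M / ((n + j : ℕ) : ℝ)) := by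
    refine antitone_nat_of_succ_le fun j => ?_
    have h1 := hN (n + j) (by omega)
    have hm : (0 : ℝ) < ((n + j : ℕ) : ℝ) := by exact_mod_cast (by omega : 0 < n + j)
    rw [← add_assoc, Nat.cast_add_one (n + j)]
    generalize ((n + j : ℕ) : ℝ) = m at *
    have h2 : u (n + j + 1) - u (n + j) ≤ M / (m * (m + 1)) := by
      rw [le_div_iff₀ (by positivity)]; linarith
    have h3 : M / (m * (m + 1)) = M / m - M / (m + 1) := by field_simp; ring
    linarith
  have hlim : Tendsto (fun j : ℕ => u (n + j) + M / ((n + j : ℕ) : ℝ)) atTop (nhds 0) := by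
    have := (tendsto_add_atTop_iff_nat n).2 hv
    simpa only [add_comm n] using this
  have h0 := hanti.le_of_tendsto hlim 0
  simp only [add_zero] at h0
  have : 0 ≤ n * (u n + M / n) := mul_nonneg hn0.le h0
  rw [mul_add, mul_div_cancel₀ _ hn0.ne'] at this
  linarith

lemma stolz_inv (u : ℕ → ℝ) (L : ℝ) (hu : Tendsto u atTop (nhds 0))
    (h : Tendsto (fun n : ℕ => (n : ℝ) * (n + 1) * (u (n + 1) - u n)) atTop (nhds L)) :
    Tendsto (fun n : ℕ => (n : ℝ) * u n) atTop (nhds (-L)) := by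
  rw [Metric.tendsto_nhds]
  intro ε hε
  have h1 := stolz_half u (L + ε / 2) hu
    ((h.eventually (eventually_le_nhds (by linarith : L < L + ε / 2))))
  have h2 := stolz_half (fun n => - u n) (-(L - ε / 2)) (by simpa using hu.neg) (by
    filter_upwards [h.eventually (eventually_ge_nhds (by linarith : L - ε / 2 < L))] with n hn
    linarith)
  filter_upwards [h1, h2] with n h1 h2
  rw [Real.dist_eq, abs_lt]
  constructor <;> linarith

/-- Second-order expansion of `(1+x)^a` at `0+`. -/
lemma rpow_second_order (a : ℝ) :
    Tendsto (fun x : ℝ => ((1 + x) ^ a - 1 - a * x) / x ^ 2) (nhdsWithin 0 (Set.Ioi 0))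
      (nhds (a * (a - 1) / 2)) := by
  have hd : ∀ (b x : ℝ), 0 ≤ x → HasDerivAt (fun x : ℝ => (1 + x) ^ b) (b * (1 + x) ^ (b - 1)) x := by
    intro b x hx
    have := ((hasDerivAt_id x).const_add 1).rpow_const (p := b) (Or.inl (by simp; linarith))
    simpa using this
  refine HasDerivAt.lhopital_zero_nhdsGT (f' := fun x => a * (1 + x) ^ (a - 1) - a)
    (g' := fun x => 2 * x) ?_ ?_ ?_ ?_ ?_ ?_
  · filter_upwards [self_mem_nhdsWithin] with x hx
    have := ((hd a x (le_of_lt hx)).sub_const 1).sub ((hasDerivAt_id x).const_mul a)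
    rw [mul_one] at this
    exact this
  · filter_upwards with x
    simpa using hasDerivAt_pow 2 x
  · filter_upwards [self_mem_nhdsWithin] with x hx
    have : (0 : ℝ) < x := hx
    positivity
  · have : ContinuousAt (fun x : ℝ => (1 + x) ^ a - 1 - a * x) 0 :=
      ((hd a 0 le_rfl).continuousAt.sub continuousAt_const).sub (by fun_prop)
    simpa [ContinuousAt] using this.tendsto.mono_left nhdsWithin_le_nhds
  · have : ContinuousAt (fun x : ℝ => x ^ 2) 0 := by fun_prop
    simpa [ContinuousAt] using this.tendsto.mono_left nhdsWithin_le_nhds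
  · have h := (hasDerivAt_iff_tendsto_slope.1 (hd (a - 1) 0 le_rfl)).mono_left
      (nhdsWithin_mono 0 (fun x (hx : 0 < x) => hx.ne'))
    have h2 := h.const_mul (a / 2)
    have e : a / 2 * ((a - 1) * (1 + 0) ^ (a - 1 - 1)) = a * (a - 1) / 2 := by
      simp; ring
    rw [e] at h2
    refine h2.congr' ?_
    filter_upwards [self_mem_nhdsWithin] with x hx
    have : (0 : ℝ) < x := hx
    simp [slope_def_field]
    field_simp

lemma Gamma_prod (a : ℝ) (ha : 0 < a) (n : ℕ) :
    Real.Gamma (n + a) = Real.Gamma a * ∏ j ∈ Finset.range n, (a + j) := by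
  induction n with
  | zero => simp
  | succ n ih =>
    rw [Finset.prod_range_succ, ← mul_assoc, ← ih]
    have : ((n + 1 : ℕ) : ℝ) + a = (n + a) + 1 := by push_cast; ring
    rw [this, Real.Gamma_add_one (by positivity)]
    ring

lemma ratio_tendsto_one (a : ℝ) (ha : 0 < a) :
    Tendsto (fun n : ℕ => (n : ℝ) ^ a * Real.Gamma n / Real.Gamma (n + a)) atTop (nhds 1) := by
  have hG : Real.Gamma a ≠ 0 := (Real.Gamma_pos_of_pos ha).ne'
  have h1 := (Real.GammaSeq_tendsto_Gamma a).div_const (Real.Gamma a)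
  have h2 : Tendsto (fun n : ℕ => 1 + a / (n : ℝ)) atTop (nhds 1) := by
    simpa using (tendsto_const_div_atTop_nhds_zero_nat a).const_add 1
  have h3 := h1.mul h2
  rw [div_self hG, one_mul] at h3
  refine h3.congr' ?_
  filter_upwards [eventually_gt_atTop 0] with n hn
  have hn0 : (0 : ℝ) < n := by exact_mod_cast hn
  have hp : (∏ j ∈ Finset.range n, (a + j)) ≠ 0 :=
    (Finset.prod_pos fun j _ => by positivity).ne'
  have hna : a + n ≠ 0 := by positivity
  rw [Gamma_prod a ha, Real.GammaSeq, Finset.prod_range_succ, ← Real.Gamma_nat_eq_factorial,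
    Real.Gamma_add_one hn0.ne']
  field_simp
  ring

lemma ratio_second_order (a : ℝ) (ha : 0 < a) :
    Tendsto (fun n : ℕ => (n : ℝ) * ((n : ℝ) ^ a * Real.Gamma n / Real.Gamma (n + a) - 1)) atTop
      (nhds (-(a * (a - 1) / 2))) := by
  have hr := ratio_tendsto_one a ha
  refine stolz_inv _ _ (by simpa using hr.sub_const 1) ?_
  have hx : Tendsto (fun n : ℕ => 1 / (n : ℝ)) atTop (nhds 0) :=
    tendsto_const_div_atTop_nhds_zero_nat 1
  have hx' : Tendsto (fun n : ℕ => 1 / (n : ℝ)) atTop (nhdsWithin 0 (Set.Ioi 0)) := by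
    refine tendsto_nhdsWithin_iff.2 ⟨hx, ?_⟩
    filter_upwards [eventually_gt_atTop 0] with n hn
    have hn0 : (0 : ℝ) < n := by exact_mod_cast hn
    exact one_div_pos.2 hn0
  have h1 := (rpow_second_order a).comp hx'
  have h2 : Tendsto (fun n : ℕ => (1 + 1 / (n : ℝ)) / (1 + a * (1 / (n : ℝ)))) atTop (nhds 1) := by
    have := (hx.const_add 1).div ((hx.const_mul a).const_add 1) (by simp)
    simp only [mul_zero, add_zero, div_one] at this
    exact this
  have h3 := (hr.mul h2).mul h1
  rw [one_mul, one_mul] at h3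
  refine h3.congr' ?_
  filter_upwards [eventually_gt_atTop 0] with n hn
  have hn0 : (0 : ℝ) < n := by exact_mod_cast hn
  have e1 : ((n + 1 : ℕ) : ℝ) ^ a = (n : ℝ) ^ a * (1 + 1 / (n : ℝ)) ^ a := by
    rw [← Real.mul_rpow hn0.le (by positivity)]
    congr 1
    push_cast
    field_simp
  have e2 : Real.Gamma ((n + 1 : ℕ) : ℝ) = n * Real.Gamma n := by
    rw [Nat.cast_add_one, Real.Gamma_add_one hn0.ne']
  have e3 : Real.Gamma (((n + 1 : ℕ) : ℝ) + a) = (n + a) * Real.Gamma (n + a) := by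
    rw [← Real.Gamma_add_one (by positivity)]
    congr 1
    push_cast
    ring
  have hG : Real.Gamma (n + a) ≠ 0 := (Real.Gamma_pos_of_pos (by positivity)).ne'
  have hna : (n : ℝ) + a ≠ 0 := by positivity
  rw [e1, e2, e3]
  simp only [Function.comp_apply]
  generalize (1 + 1 / (n : ℝ)) ^ a = y
  generalize (n : ℝ) ^ a = z
  field_simp
  ring

theorem stmt_7 (p : ℝ) (hp0 : 0 ≤ p) (hp1 : p < 1) (P : ℕ → ℝ)
    (hP : ∀ k : ℕ, 2 < k →
      P k = (2 / (1 - p) + 2) * (2 / (1 - p) + 1) * euBeta k (1 + 2 / (1 - p)) * P 2)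
    (Cp : ℝ)
    (hCp : Cp = Real.Gamma (1 + 2 / (1 - p)) * (2 / (1 - p) + 2) * (2 / (1 - p) + 1) * P 2) :
    Tendsto (fun k : ℕ =>
        (k : ℝ) ^ (2 + 2 / (1 - p)) * (P k - Cp * (k : ℝ) ^ (-(1 + 2 / (1 - p))))) atTop
      (nhds (-Cp * (3 - p) / (1 - p) ^ 2)) := by
  have hq : 0 < 1 - p := by linarith
  set a : ℝ := 1 + 2 / (1 - p) with ha
  have ha0 : 0 < a := by positivity
  have h := (ratio_second_order a ha0).const_mul Cp
  have e : Cp * -(a * (a - 1) / 2) = -Cp * (3 - p) / (1 - p) ^ 2 := by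
    rw [ha]; field_simp; ring
  rw [e] at h
  refine h.congr' ?_
  filter_upwards [eventually_gt_atTop 2] with k hk
  have hk0 : (0 : ℝ) < k := by exact_mod_cast (by omega : 0 < k)
  have e1 : (k : ℝ) ^ (2 + 2 / (1 - p)) = k * (k : ℝ) ^ a := by
    rw [show 2 + 2 / (1 - p) = 1 + a by rw [ha]; ring, Real.rpow_add hk0, Real.rpow_one]
  have hz : (k : ℝ) ^ a ≠ 0 := (Real.rpow_pos_of_pos hk0 a).ne'
  rw [hP k hk, e1, Real.rpow_neg hk0.le, euBeta, hCp]
  have hG : Real.Gamma (k + a) ≠ 0 := (Real.Gamma_pos_of_pos (by positivity)).ne'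
  field_simp
end

section
/- Let l ≥ 2 be an integer and 0 < p ≤ 1. For t ≥ l set I₁(t) = p(l−1)/l + (1−p)(2t−1)/(2t). Let q(t,m) (t ≥ l, 1 ≤ m ≤ l) be real numbers satisfying q(l,m) = 1 for all 1 ≤ m ≤ l, q(t,l) = 1 for all t ≥ l, and q(t+1,m) = I₁(t)·q(t,m+1) for all t ≥ l and 1 ≤ m < l. Then lim_{t→∞} Σ_{m=1}^{l} q(t,m) = l/p − (l/p)·(1−p/l)^l. -/
open Filter Finset

theorem stmt_8 (l : ℕ) (hl : 2 ≤ l) (p : ℝ) (hp0 : 0 < p) (hp1 : p ≤ 1)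
    (q : ℕ → ℕ → ℝ)
    (hinit : ∀ m : ℕ, 1 ≤ m → m ≤ l → q l m = 1)
    (hlast : ∀ t : ℕ, l ≤ t → q t l = 1)
    (hrec : ∀ t : ℕ, l ≤ t → ∀ m : ℕ, 1 ≤ m → m < l →
      q (t + 1) m = (p * ((l : ℝ) - 1) / l + (1 - p) * (2 * t - 1) / (2 * t)) * q t (m + 1)) :
    Tendsto (fun t : ℕ => ∑ m ∈ Finset.Icc 1 l, q t m) atTop
      (nhds ((l : ℝ) / p - ((l : ℝ) / p) * (1 - p / l) ^ l)) := by
  have hl0 : (l : ℝ) ≠ 0 := by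
    have : l ≠ 0 := by omega
    exact_mod_cast this
  have hI : Tendsto (fun t : ℕ => p * ((l : ℝ) - 1) / l + (1 - p) * (2 * (t : ℝ) - 1) / (2 * t))
      atTop (nhds (1 - p / l)) := by
    have h1 : Tendsto (fun t : ℕ => (1 - p / l) - ((1 - p) / 2) * (1 / (t : ℝ))) atTop
        (nhds ((1 - p / l) - ((1 - p) / 2) * 0)) :=
      (tendsto_one_div_atTop_nhds_zero_nat.const_mul _).const_sub _
    rw [mul_zero, sub_zero] at h1
    refine h1.congr' ?_
    filter_upwards [eventually_gt_atTop 0] with t ht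
    have ht0 : (t : ℝ) ≠ 0 := by
      have : t ≠ 0 := by omega
      exact_mod_cast this
    field_simp
    ring
  have key : ∀ k : ℕ, k < l → Tendsto (fun t : ℕ => q t (l - k)) atTop
      (nhds ((1 - p / l) ^ k)) := by
    intro k
    induction k with
    | zero =>
      intro _
      rw [pow_zero]
      refine tendsto_const_nhds.congr' ?_
      filter_upwards [eventually_ge_atTop l] with t ht
      exact (hlast t ht).symm
    | succ k ih =>
      intro hk
      rw [← tendsto_add_atTop_iff_nat 1, pow_succ']
      refine (hI.mul (ih (by omega))).congr' ?_
      filter_upwards [eventually_ge_atTop l] with t ht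
      rw [hrec t ht (l - (k + 1)) (by omega) (by omega),
        show l - (k + 1) + 1 = l - k by omega]
  have hsum : ∀ t, ∑ m ∈ Finset.Icc 1 l, q t m = ∑ k ∈ Finset.range l, q t (l - k) := by
    intro t
    refine Finset.sum_bij' (fun m _ => l - m) (fun k _ => l - k) ?_ ?_ ?_ ?_ ?_
    · intro a ha; simp only [Finset.mem_Icc, Finset.mem_range] at *; omega
    · intro a ha; simp only [Finset.mem_Icc, Finset.mem_range] at *; omega
    · intro a ha; simp only [Finset.mem_Icc] at *; omega
    · intro a ha; simp only [Finset.mem_range] at *; omega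
    · intro a ha
      simp only [Finset.mem_Icc] at ha
      rw [show l - (l - a) = a by omega]
  simp only [hsum]
  have hlim := tendsto_finsetSum (Finset.range l)
    (fun k hk => key k (Finset.mem_range.mp hk))
  have hg := mul_neg_geom_sum (1 - p / (l : ℝ)) l
  have hval : ∑ k ∈ Finset.range l, (1 - p / (l : ℝ)) ^ k
      = (l : ℝ) / p - ((l : ℝ) / p) * (1 - p / l) ^ l := by
    have : (l : ℝ) / p * (p / l) = 1 := by field_simp
    calc _ = ((l : ℝ) / p * (p / l)) * ∑ k ∈ Finset.range l, (1 - p / (l : ℝ)) ^ k := by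
          rw [this, one_mul]
      _ = (l : ℝ) / p * ((1 - (1 - p / l)) * ∑ k ∈ Finset.range l, (1 - p / (l : ℝ)) ^ k) := by
          ring
      _ = _ := by rw [hg]; ring
  rw [← hval]
  exact hlim
end

section
/- Let l ≥ 2 be an integer, 0 < p < 1, and H ∈ ℝ with 0 ≤ H ≤ l. Let h : ℕ → ℝ satisfy 0 ≤ h(t) ≤ l for all t ≥ l and lim_{t→∞} h(t) = H, and let n : ℕ → ℝ satisfy n(l) = l and, for all integers t ≥ l, n(t+1) = n(t) + 1 − (p/l)·h(t) − (1−p)·n(t)/(2t). Then lim_{t→∞} n(t)/t = 2·(1 − pH/l)/(3−p). In particular, if H = l/p − (l/p)·(1−p/l)^l, then lim_{t→∞} n(t)/t = (2/(3−p))·(1−p/l)^l. -/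
open Filter

theorem stmt_10 (l : ℕ) (hl : 2 ≤ l) (p : ℝ) (hp0 : 0 < p) (hp1 : p < 1)
    (H : ℝ) (hH0 : 0 ≤ H) (hHl : H ≤ l) (h : ℕ → ℝ)
    (hh0 : ∀ t : ℕ, l ≤ t → 0 ≤ h t) (hhl : ∀ t : ℕ, l ≤ t → h t ≤ l)
    (hhlim : Tendsto h atTop (nhds H))
    (n : ℕ → ℝ) (hninit : n l = l)
    (hrec : ∀ t : ℕ, l ≤ t →
      n (t + 1) = n t + 1 - (p / l) * h t - (1 - p) * n t / (2 * t)) :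
    Tendsto (fun t : ℕ => n t / t) atTop (nhds (2 * (1 - p * H / l) / (3 - p))) ∧
    (H = (l : ℝ) / p - ((l : ℝ) / p) * (1 - p / l) ^ l →
      Tendsto (fun t : ℕ => n t / t) atTop (nhds ((2 / (3 - p)) * (1 - p / l) ^ l))) := by
  have hl0 : (0 : ℝ) < l := by
    have : 0 < l := by omega
    exact_mod_cast this
  have h3p : (3 - p) ≠ 0 := by linarith
  have main : Tendsto (fun t : ℕ => n t / t) atTop
      (nhds (2 * (1 - p * H / l) / (3 - p))) := by
    set L : ℝ := 2 * (1 - p * H / l) / (3 - p) with hL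
    have hL' : L * (3 - p) = 2 * (1 - p * H / l) := by
      rw [hL]; field_simp
    let d : ℕ → ℝ := fun t => (p / l) * (H - h t)
    have hd : Tendsto (fun t => |d t|) atTop (nhds 0) := by
      have h1 : Tendsto d atTop (nhds ((p / l) * (H - H))) :=
        (tendsto_const_nhds.sub hhlim).const_mul _
      simpa using h1.abs
    have hbound : ∀ t : ℕ, l ≤ t →
        |n t - L * t| ≤ |n l - L * l| + ∑ i ∈ Finset.range t, |d i| := by
      intro t ht
      induction t, ht using Nat.le_induction with
      | base =>
        have : 0 ≤ ∑ i ∈ Finset.range l, |d i| := Finset.sum_nonneg fun i _ => abs_nonneg _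
        linarith
      | succ t ht ih =>
        have ht2 : (2 : ℝ) ≤ t := by exact_mod_cast hl.trans ht
        have ht0 : (t : ℝ) ≠ 0 := by linarith
        have e1 : n (t + 1) - L * ((t + 1 : ℕ) : ℝ)
            = (n t - L * t) * (1 - (1 - p) / (2 * t)) + d t := by
          have e2 : (1 - p) * n t / (2 * t)
              = (n t - L * t) * ((1 - p) / (2 * t)) + L * (1 - p) / 2 := by
            field_simp
            ring
          rw [hrec t ht, e2]
          have e3 : p * H / l = (p / l) * H := by ring
          rw [e3] at hL'
          push_cast
          simp only [d]
          linear_combination (-1 / 2) * hL'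
        have hq0 : 0 ≤ (1 - p) / (2 * (t : ℝ)) := by
          apply div_nonneg <;> linarith
        have hq1 : (1 - p) / (2 * (t : ℝ)) ≤ 1 := by
          rw [div_le_one (by linarith)]; linarith
        rw [e1, Finset.sum_range_succ]
        have := abs_add_le ((n t - L * t) * (1 - (1 - p) / (2 * t))) (d t)
        rw [abs_mul, abs_of_nonneg (by linarith : 0 ≤ 1 - (1 - p) / (2 * (t : ℝ)))] at this
        have h5 : |n t - L * t| * (1 - (1 - p) / (2 * (t : ℝ))) ≤ |n t - L * t| :=
          mul_le_of_le_one_right (abs_nonneg _) (by linarith)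
        linarith
    have hces := hd.cesaro
    have hC : Tendsto (fun t : ℕ => |n l - L * l| / (t : ℝ)) atTop (nhds 0) :=
      tendsto_const_div_atTop_nhds_zero_nat _
    have hsum := hC.add hces
    rw [add_zero] at hsum
    rw [tendsto_iff_norm_sub_tendsto_zero]
    refine squeeze_zero' (Eventually.of_forall fun t => norm_nonneg _) ?_ hsum
    filter_upwards [eventually_ge_atTop l] with t ht
    have ht0 : (0 : ℝ) < t := lt_of_lt_of_le hl0 (by exact_mod_cast ht)
    have e4 : n t / t - L = (n t - L * t) / t := by field_simp
    rw [e4, Real.norm_eq_abs, abs_div, abs_of_pos ht0, inv_mul_eq_div, ← add_div]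
    exact div_le_div_of_nonneg_right (hbound t ht) ht0.le
  refine ⟨main, fun hHeq => ?_⟩
  have e5 : 2 * (1 - p * H / l) / (3 - p) = (2 / (3 - p)) * (1 - p / l) ^ l := by
    have e6 : p * H / l = 1 - (1 - p / l) ^ l := by
      rw [hHeq]
      generalize (1 - p / (l : ℝ)) ^ l = x
      field_simp
    rw [e6]; ring
  rwa [e5] at main
end

section
/- Let l ≥ 2 and k ≥ 2 be integers, 0 ≤ p < 1, and let H_{k−1}, H_k, P_{k−1} ∈ ℝ. Let h_{k−1}, h_k : ℕ → ℝ satisfy 0 ≤ h_{k−1}(t) ≤ l and 0 ≤ h_k(t) ≤ l for all t ≥ l, lim_{t→∞} h_{k−1}(t) = H_{k−1} and lim_{t→∞} h_k(t) = H_k. Let n_{k−1}, n_k : ℕ → ℝ be nonnegative sequences with lim_{t→∞} n_{k−1}(t)/t = P_{k−1}, satisfying for all integers t ≥ l: n_k(t+1) = n_k(t) + (p/l)·(h_{k−1}(t) − h_k(t)) + ((1−p)/(2t))·((k−1)·n_{k−1}(t) − k·n_k(t)). Then lim_{t→∞} n_k(t)/t = (2/(2+k(1−p)))·((p/l)·(H_{k−1}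 − H_k) + ((1−p)(k−1)/2)·P_{k−1}). -/
open Filter

theorem aux_growth (e : ℕ → ℝ)
    (h : ∀ ε : ℝ, 0 < ε → ∃ T : ℕ, ∀ t, T ≤ t → |e (t + 1)| ≤ |e t| + ε) :
    Tendsto (fun t : ℕ => e t / t) atTop (nhds 0) := by
  rw [Metric.tendsto_atTop]
  intro ε hε
  obtain ⟨T, hT⟩ := h (ε / 2) (by linarith)
  have hb : ∀ s : ℕ, |e (T + s)| ≤ |e T| + s * (ε / 2) := by
    intro s
    induction s with
    | zero => simp
    | succ s ih =>
      have := hT (T + s) (by omega)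
      rw [← add_assoc]
      push_cast
      linarith
  obtain ⟨N, hN⟩ := exists_nat_gt (|e T| / (ε / 2))
  rw [div_lt_iff₀ (by linarith)] at hN
  refine ⟨max (N + 1) T, fun t ht => ?_⟩
  have h1 : N + 1 ≤ t := le_trans (le_max_left _ _) ht
  obtain ⟨s, rfl⟩ := Nat.exists_eq_add_of_le (le_trans (le_max_right _ _) ht)
  have hpos : (0 : ℝ) < ((T + s : ℕ) : ℝ) := by
    exact_mod_cast (by omega : 0 < T + s)
  have h2 : (N : ℝ) ≤ ((T + s : ℕ) : ℝ) := by exact_mod_cast (by omega : N ≤ T + s)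
  have h3 : (s : ℝ) ≤ ((T + s : ℕ) : ℝ) := by exact_mod_cast (by omega : s ≤ T + s)
  rw [Real.dist_eq, sub_zero, abs_div, abs_of_pos hpos, div_lt_iff₀ hpos]
  have := hb s
  nlinarith


theorem stmt_11 (l k : ℕ) (hl : 2 ≤ l) (hk : 2 ≤ k) (p : ℝ) (hp0 : 0 ≤ p) (hp1 : p < 1)
    (Hkm Hk Pkm : ℝ) (hkm hk' : ℕ → ℝ)
    (hhkm0 : ∀ t : ℕ, l ≤ t → 0 ≤ hkm t) (hhkml : ∀ t : ℕ, l ≤ t → hkm t ≤ l)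
    (hhk0 : ∀ t : ℕ, l ≤ t → 0 ≤ hk' t) (hhkl : ∀ t : ℕ, l ≤ t → hk' t ≤ l)
    (hlimkm : Tendsto hkm atTop (nhds Hkm))
    (hlimk : Tendsto hk' atTop (nhds Hk))
    (nkm nk : ℕ → ℝ)
    (hnkm0 : ∀ t : ℕ, 0 ≤ nkm t) (hnk0 : ∀ t : ℕ, 0 ≤ nk t)
    (hPkm : Tendsto (fun t : ℕ => nkm t / t) atTop (nhds Pkm))
    (hrec : ∀ t : ℕ, l ≤ t →
      nk (t + 1) = nk t + (p / l) * (hkm t - hk' t)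
        + ((1 - p) / (2 * t)) * (((k : ℝ) - 1) * nkm t - k * nk t)) :
    Tendsto (fun t : ℕ => nk t / t) atTop
      (nhds ((2 / (2 + k * (1 - p))) *
        ((p / l) * (Hkm - Hk) + ((1 - p) * ((k : ℝ) - 1) / 2) * Pkm))) := by
  have hl0 : (0 : ℝ) < l := by exact_mod_cast (by omega : 0 < l)
  have hk0 : (0 : ℝ) < k := by exact_mod_cast (by omega : 0 < k)
  have hb : 0 < (k : ℝ) * (1 - p) := mul_pos hk0 (by linarith)
  set G : ℝ := (p / l) * (Hkm - Hk) + ((1 - p) * ((k : ℝ) - 1) / 2) * Pkm with hG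
  set c : ℝ := (2 / (2 + k * (1 - p))) * G with hc
  have hcG : c + k * (1 - p) / 2 * c = G := by
    rw [hc]
    have : (2 + (k : ℝ) * (1 - p)) ≠ 0 := by linarith
    field_simp
  have hg : Tendsto (fun t : ℕ => (p / l) * (hkm t - hk' t)
      + ((1 - p) * ((k : ℝ) - 1) / 2) * (nkm t / t)) atTop (nhds G) :=
    ((hlimkm.sub hlimk).const_mul _).add (hPkm.const_mul _)
  have key : Tendsto (fun t : ℕ => (nk t - c * t) / t) atTop (nhds 0) := by
    apply aux_growth (fun t : ℕ => nk t - c * t)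
    intro ε hε
    obtain ⟨T, hT⟩ := Metric.tendsto_atTop.1 hg ε hε
    obtain ⟨N, hN⟩ := exists_nat_gt ((k : ℝ) * (1 - p) / 2)
    refine ⟨T + N + l, fun t ht => ?_⟩
    have hd := hT t (by omega)
    rw [Real.dist_eq] at hd
    have ht0 : (0 : ℝ) < t := by exact_mod_cast (by omega : 0 < t)
    have hNt : (N : ℝ) ≤ t := by exact_mod_cast (by omega : N ≤ t)
    have hq0 : 0 ≤ (k : ℝ) * (1 - p) / 2 / t := by positivity
    have hq1 : (k : ℝ) * (1 - p) / 2 / t ≤ 1 := by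
      rw [div_le_one ht0]; linarith
    have heq : nk (t + 1) - c * ((t + 1 : ℕ) : ℝ)
        = (1 - (k : ℝ) * (1 - p) / 2 / t) * (nk t - c * t)
          + ((p / l) * (hkm t - hk' t)
            + ((1 - p) * ((k : ℝ) - 1) / 2) * (nkm t / t) - G) := by
      rw [hrec t (by omega), ← hcG]
      push_cast
      field_simp
      ring
    show |nk (t + 1) - c * ((t + 1 : ℕ) : ℝ)| ≤ |nk t - c * t| + ε
    rw [heq]
    refine (abs_add_le _ _).trans (add_le_add ?_ hd.le)
    rw [abs_mul, abs_of_nonneg (by linarith)]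
    exact mul_le_of_le_one_left (abs_nonneg _) (by linarith)
  have := key.add_const c
  rw [zero_add] at this
  refine this.congr' ?_
  filter_upwards [eventually_gt_atTop 0] with t ht
  have ht0 : (t : ℝ) ≠ 0 := by exact_mod_cast ht.ne'
  field_simp
  ring
end

section
/- Let l ≥ 1 be an integer, 0 ≤ p < 1, and let P : ℕ → ℝ satisfy P(k) = ((1−p)(k−1)/(2+(1−p)k))·P(k−1) for every integer k > l+1. Then for every integer k > l+1, P(k) = (B(k, l+2+2/(1−p)) / B(l+1, k+1+2/(1−p)))·P(l+1), where B denotes the Euler Beta function. -/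
/-- Gamma form of the quotient, by induction from `k = l + 1`. -/
theorem upa_aux (l : ℕ) (p : ℝ) (hp1 : p < 1) (P : ℕ → ℝ)
    (hrec : ∀ k : ℕ, l + 1 < k →
      P k = ((1 - p) * ((k : ℝ) - 1) / (2 + (1 - p) * k)) * P (k - 1))
    (k : ℕ) (hk : l + 1 ≤ k) :
    P k * (Real.Gamma ((l : ℝ) + 1) * Real.Gamma ((k : ℝ) + 1 + 2 / (1 - p))) =
      Real.Gamma k * Real.Gamma ((l : ℝ) + 2 + 2 / (1 - p)) * P (l + 1) := by
  have hq : 0 < 1 - p := by linarith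
  induction k, hk using Nat.le_induction with
  | base =>
    have h : ((l + 1 : ℕ) : ℝ) + 1 + 2 / (1 - p) = (l : ℝ) + 2 + 2 / (1 - p) := by
      push_cast; ring
    rw [h]; push_cast; ring
  | succ n hn ih =>
    have hn0 : (0 : ℝ) < n := by exact_mod_cast (by omega : 0 < n)
    have hc : 0 < 2 / (1 - p) := by positivity
    have h1 : Real.Gamma (((n + 1 : ℕ) : ℝ) + 1 + 2 / (1 - p)) =
        ((n : ℝ) + 1 + 2 / (1 - p)) * Real.Gamma ((n : ℝ) + 1 + 2 / (1 - p)) := by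
      rw [← Real.Gamma_add_one (by positivity)]
      congr 1; push_cast; ring
    have h2 : Real.Gamma ((n + 1 : ℕ) : ℝ) = n * Real.Gamma n := by
      push_cast; exact Real.Gamma_add_one hn0.ne'
    have h3 : (1 - p) * (((n + 1 : ℕ) : ℝ) - 1) / (2 + (1 - p) * ((n + 1 : ℕ) : ℝ)) *
        ((n : ℝ) + 1 + 2 / (1 - p)) = n := by
      have : (2 + (1 - p) * ((n : ℝ) + 1)) ≠ 0 := by positivity
      push_cast
      field_simp
      ring
    rw [hrec (n + 1) (by omega), h1, h2, Nat.add_sub_cancel]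
    linear_combination (n : ℝ) * ih + P n * Real.Gamma ((l : ℝ) + 1) *
      Real.Gamma ((n : ℝ) + 1 + 2 / (1 - p)) * h3

theorem stmt_12 (l : ℕ) (hl : 1 ≤ l) (p : ℝ) (hp0 : 0 ≤ p) (hp1 : p < 1) (P : ℕ → ℝ)
    (hrec : ∀ k : ℕ, l + 1 < k →
      P k = ((1 - p) * ((k : ℝ) - 1) / (2 + (1 - p) * k)) * P (k - 1)) :
    ∀ k : ℕ, l + 1 < k →
      P k = (euBeta k ((l : ℝ) + 2 + 2 / (1 - p))
        / euBeta ((l : ℝ) + 1) ((k : ℝ) + 1 + 2 / (1 - p))) * P (l + 1) := by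
  intro k hk
  have h := upa_aux l p hp1 P hrec k hk.le
  have hq : 0 < 1 - p := by linarith
  have hc : 0 < 2 / (1 - p) := by positivity
  have hs : (l : ℝ) + 1 + ((k : ℝ) + 1 + 2 / (1 - p)) = k + ((l : ℝ) + 2 + 2 / (1 - p)) := by ring
  have g1 : Real.Gamma ((l : ℝ) + 1) ≠ 0 := (Real.Gamma_pos_of_pos (by positivity)).ne'
  have g2 : Real.Gamma ((k : ℝ) + 1 + 2 / (1 - p)) ≠ 0 :=
    (Real.Gamma_pos_of_pos (by positivity)).ne'
  have g3 : Real.Gamma ((k : ℝ) + ((l : ℝ) + 2 + 2 / (1 - p))) ≠ 0 :=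
    (Real.Gamma_pos_of_pos (by positivity)).ne'
  unfold euBeta
  rw [hs, div_div_div_cancel_right₀ g3, div_mul_eq_mul_div, eq_div_iff (mul_ne_zero g1 g2)]
  exact h
end

section
/- Let l ≥ 1 be an integer, 0 ≤ p < 1, and let P : ℕ → ℝ satisfy, for every integer k > l+1, P(k) = (B(k, l+2+2/(1−p)) / B(l+1, k+1+2/(1−p)))·P(l+1), where B denotes the Euler Beta function. Then lim_{k→∞} k^{1+2/(1−p)}·P(k) = C_{p,l}, where C_{p,l} = (Γ(l+2+2/(1−p)) / Γ(l+1))·P(l+1). -/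
open Filter

lemma prod_gamma (s : ℝ) (hs : 0 < s) (n : ℕ) :
    (∏ j ∈ Finset.range n, (s + j)) * Real.Gamma s = Real.Gamma (s + n) := by
  induction n with
  | zero => simp
  | succ n ih =>
    have h : s + ((n + 1 : ℕ) : ℝ) = (s + n) + 1 := by push_cast; ring
    rw [Finset.prod_range_succ, h, Real.Gamma_add_one (by positivity), ← ih]
    ring

lemma ratio_tendsto (s : ℝ) (hs : 0 < s) :
    Tendsto (fun k : ℕ => (k : ℝ) ^ s * (Real.Gamma k / Real.Gamma (k + s))) atTop (nhds 1) := by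
  have h1 := Real.GammaSeq_tendsto_Gamma s
  have hg : Real.Gamma s ≠ 0 := (Real.Gamma_pos_of_pos hs).ne'
  have h2 : Tendsto (fun k : ℕ => s / (k : ℝ) + 1) atTop (nhds (0 + 1)) :=
    (tendsto_const_div_atTop_nhds_zero_nat s).add tendsto_const_nhds
  have h3 := (h1.div_const (Real.Gamma s)).mul h2
  rw [div_self hg, zero_add, mul_one] at h3
  refine h3.congr' ?_
  filter_upwards [eventually_gt_atTop 0] with k hk
  have hk' : (0 : ℝ) < k := by exact_mod_cast hk
  have hsk : (0 : ℝ) < s + k := by positivity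
  have hp := prod_gamma s hs k
  have hG : Real.Gamma (s + k) ≠ 0 := (Real.Gamma_pos_of_pos hsk).ne'
  have hf : ((k.factorial : ℕ) : ℝ) = k * Real.Gamma k := by
    rw [← Real.Gamma_add_one hk'.ne', Real.Gamma_nat_eq_factorial]
  have hP0 : (∏ j ∈ Finset.range k, (s + (j : ℝ))) ≠ 0 := by
    intro h0
    rw [h0, zero_mul] at hp
    exact hG hp.symm
  rw [Real.GammaSeq, Finset.prod_range_succ, hf, add_comm (k : ℝ) s, ← hp]
  field_simp

theorem stmt_13 (l : ℕ) (hl : 1 ≤ l) (p : ℝ) (hp0 : 0 ≤ p) (hp1 : p < 1) (P : ℕ → ℝ)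
    (hP : ∀ k : ℕ, l + 1 < k →
      P k = (euBeta k ((l : ℝ) + 2 + 2 / (1 - p))
        / euBeta ((l : ℝ) + 1) ((k : ℝ) + 1 + 2 / (1 - p))) * P (l + 1)) :
    Tendsto (fun k : ℕ => (k : ℝ) ^ (1 + 2 / (1 - p)) * P k) atTop
      (nhds ((Real.Gamma ((l : ℝ) + 2 + 2 / (1 - p)) / Real.Gamma ((l : ℝ) + 1))
        * P (l + 1))) := by
  have ha : 0 < 2 / (1 - p) := div_pos two_pos (by linarith)
  generalize 2 / (1 - p) = a at *
  have h := (ratio_tendsto (1 + a) (by linarith)).mul_const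
    ((Real.Gamma ((l : ℝ) + 2 + a) / Real.Gamma ((l : ℝ) + 1)) * P (l + 1))
  rw [one_mul] at h
  refine h.congr' ?_
  filter_upwards [eventually_gt_atTop (l + 1)] with k hk
  have e : (k : ℝ) + (l + 2 + a) = l + 1 + (k + 1 + a) := by ring
  have h1 : Real.Gamma ((l : ℝ) + 1 + (k + 1 + a)) ≠ 0 :=
    (Real.Gamma_pos_of_pos (by positivity)).ne'
  have h2 : Real.Gamma ((k : ℝ) + 1 + a) ≠ 0 := (Real.Gamma_pos_of_pos (by positivity)).ne'
  have h3 : Real.Gamma ((l : ℝ) + 1) ≠ 0 := (Real.Gamma_pos_of_pos (by positivity)).ne'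
  rw [hP k hk, euBeta, euBeta, e, ← add_assoc (k : ℝ) 1 a]
  field_simp
end

section
/- Let 0 ≤ p ≤ 1, let t ≥ 1 be an integer, and let n : ℕ → ℝ be a sequence with n(t) > 0 satisfying n(t+1) = (1 − (1−p)/(2t))·n(t) + (1−p). Then n(t+1)/(t+1) ≤ n(t)/t if and only if 2(1−p)/(3−p) ≤ n(t)/t, and likewise n(t+1)/(t+1) ≥ n(t)/t if and only if 2(1−p)/(3−p) ≥ n(t)/t. -/
theorem stmt_14 (p : ℝ) (hp0 : 0 ≤ p) (hp1 : p ≤ 1) (t : ℕ) (ht : 1 ≤ t)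
    (n : ℕ → ℝ) (hpos : 0 < n t)
    (hrec : n (t + 1) = (1 - (1 - p) / (2 * t)) * n t + (1 - p)) :
    (n (t + 1) / (t + 1) ≤ n t / t ↔ 2 * (1 - p) / (3 - p) ≤ n t / t) ∧
    (n t / t ≤ n (t + 1) / (t + 1) ↔ n t / t ≤ 2 * (1 - p) / (3 - p)) := by
  have h3 : (0 : ℝ) < 3 - p := by linarith
  have ht0 : (0 : ℝ) < t := by exact_mod_cast ht
  have ht1 : (0 : ℝ) < (t : ℝ) + 1 := by linarith
  obtain ⟨x, hx⟩ : ∃ x, x = n t / (t : ℝ) := ⟨_, rfl⟩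
  have hn : n t = x * t := by rw [hx]; field_simp
  have h1 : n (t + 1) = t * x - (1 - p) * x / 2 + (1 - p) := by
    rw [hrec, hn]; field_simp
  rw [← hx, h1, div_le_iff₀ ht1, le_div_iff₀ ht1, div_le_iff₀ h3, le_div_iff₀ h3]
  refine ⟨⟨fun h => ?_, fun h => ?_⟩, ⟨fun h => ?_, fun h => ?_⟩⟩ <;> nlinarith
end

section
/- Let 0 ≤ p ≤ 1, let t ≥ 1 be an integer, and let n : ℕ → ℝ satisfy n(t+1) = (1 − (1−p)/(2t))·n(t) + (1−p). If n(t) < t·2(1−p)/(3−p), then n(t+1) < (t+1)·2(1−p)/(3−p). -/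
theorem stmt_15 (p : ℝ) (hp0 : 0 ≤ p) (hp1 : p ≤ 1) (t : ℕ) (ht : 1 ≤ t)
    (n : ℕ → ℝ)
    (hrec : n (t + 1) = (1 - (1 - p) / (2 * t)) * n t + (1 - p))
    (hlt : n t < t * (2 * (1 - p) / (3 - p))) :
    n (t + 1) < (t + 1) * (2 * (1 - p) / (3 - p)) := by
  have ht' : (1 : ℝ) ≤ t := by exact_mod_cast ht
  have h3 : (3 - p) ≠ 0 := by linarith
  have ht0 : (t : ℝ) ≠ 0 := by linarith
  have ha : 0 < 1 - (1 - p) / (2 * (t : ℝ)) := by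
    rw [sub_pos, div_lt_one (by linarith)]
    linarith
  have h := mul_lt_mul_of_pos_left hlt ha
  have e : (1 - (1 - p) / (2 * (t : ℝ))) * (t * (2 * (1 - p) / (3 - p))) + (1 - p)
      = (t + 1) * (2 * (1 - p) / (3 - p)) := by
    field_simp
    ring
  rw [hrec]
  linarith
end
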